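/- The normalized volumes of rank-2 Schubert matroid polytopes satisfy: σ_n(1, ℓ−1) + σ_n(1, ℓ) + ℓ = σ_{n+1}(1, ℓ) for ℓ ≥ 2 (with σ_n(1,ℓ) := 0 when the parameters are out of range), σ_n(1,1) = n − 2 for every n ≥ 3, and moreover for each 1 ≤ ℓ ≤ n−3, the Eulerian number A_{1,n−1} (the number of permutations of [n−1] with exactly one descent) satisfies A_{1,n−1} = σ_n(1, ℓ) + σ_n(1, n−ℓ−2). -/

import Mathlib

/-!
Statement 13: The normalized volumes of rank-2 Schubert matroid polytopes satisfy
`σ_n(1, ℓ-1) + σ_n(1, ℓ) + ℓ = σ_{n+1}(1, ℓ)`, `σ_n(1,1) = n - 2` for `n ≥ 3`, and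
`A_{1,n-1} = σ_n(1, ℓ) + σ_n(1, n-ℓ-2)` for `1 ≤ ℓ ≤ n - 3`, where `A_{1,m}` is the
Eulerian number counting permutations of `[m]` with exactly one descent.
-/

open scoped Classical Pointwise

/-- The height of the lattice path associated to `A ⊆ [n]` after `i` steps:
the number of north steps (elements of `A`) among the first `i` steps. -/
def pathHeight {n : ℕ} (A : Finset (Fin n)) (i : ℕ) : ℕ :=
  (A.filter fun j => j.val < i).card

/-- The 0/1 indicator vector of a subset of `[n]`. -/
def indVec {n : ℕ} (B : Finset (Fin n)) : Fin n → ℝ :=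
  fun i => if i ∈ B then 1 else 0

/-- Height after `i` steps of the upper path `U` of `M_n[k,ℓ]`, which has north steps
at positions `1` and `n - ℓ`. -/
def upperHt (n l i : ℕ) : ℕ :=
  (if 1 ≤ i then 1 else 0) + (if n - l ≤ i then 1 else 0)

/-- Height after `i` steps of the lower path `L` of `M_n[k,ℓ]`, which has its two
north steps at the end of the diagram (positions `n - k` and `n`). -/
def lowerHt (n k i : ℕ) : ℕ :=
  (if n - k ≤ i then 1 else 0) + (if n ≤ i then 1 else 0)

/-- The bases of the rank-2 lattice path matroid `M_n[k,ℓ]`: all `2`-subsets of `[n]`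
whose lattice path lies weakly between the lower and upper paths. -/
noncomputable def MklBases (n k l : ℕ) : Finset (Finset (Fin n)) :=
  Finset.univ.filter fun B => B.card = 2 ∧
    ∀ i ∈ Finset.range (n + 1),
      lowerHt n k i ≤ pathHeight B i ∧ pathHeight B i ≤ upperHt n l i

/-- The matroid polytope of `M_n[k,ℓ]`. -/
noncomputable def MklPolytope (n k l : ℕ) : Set (Fin n → ℝ) :=
  convexHull ℝ {x | ∃ B ∈ MklBases n k l, x = indVec B}

/-- The number of lattice (integer) points of a subset of `ℝⁿ`. -/
noncomputable def latticeCount {n : ℕ} (S : Set (Fin n → ℝ)) : ℕ :=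
  Set.ncard {x ∈ S | ∀ i, ∃ m : ℤ, x i = (m : ℝ)}

/-- The normalized volume of a `d`-dimensional lattice polytope `P`: the `d`-th finite
difference at `0` of the Ehrhart counting function, i.e. `d! · vol(P)`. -/
noncomputable def normVol {n : ℕ} (P : Set (Fin n → ℝ)) (d : ℕ) : ℤ :=
  ∑ j ∈ Finset.range (d + 1),
    (-1 : ℤ) ^ j * (d.choose j : ℤ) * (latticeCount (((d - j : ℕ) : ℝ) • P) : ℤ)

/-- `σ_n(k,ℓ)`: the normalized volume of the rank-2 lattice path matroid polytope
`P_{M_n[k,ℓ]}`, set to `0` when the parameters are out of range. -/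
noncomputable def sigmaVol (n k l : ℕ) : ℤ :=
  if 1 ≤ k ∧ k ≤ l ∧ l ≤ n - 2 then normVol (MklPolytope n k l) (n - 1) else 0

/-- The one-line notation of a permutation of `[m]` (0-based values), extended by `0`
outside the range. -/
def oneLine {m : ℕ} (π : Equiv.Perm (Fin m)) (i : ℕ) : ℕ :=
  if h : i < m then (π ⟨i, h⟩ : ℕ) else 0

/-- The number of descents of a permutation of `[m]`. -/
def descentCount {m : ℕ} (π : Equiv.Perm (Fin m)) : ℕ :=
  ((Finset.range m).filter fun i => i + 1 < m ∧ oneLine π (i + 1) < oneLine π i).card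

/-- The Eulerian number `A_{1,m}`: the number of permutations of `[m]` with exactly
one descent. -/
def eulerianOne (m : ℕ) : ℕ :=
  (Finset.univ.filter fun π : Equiv.Perm (Fin m) => descentCount π = 1).card

/-- The top-order forward difference of a product of two shifted binomial coefficients. -/
lemma fwdDiff_iter_choose_mul_choose (i k a b : ℕ) :
    ((fwdDiff 1)^[i + k] (fun t : ℕ ↦ ((t + a).choose i * (t + b).choose k : ℤ))) =
      fun _ ↦ ((i + k).choose i : ℤ) := by
  induction hd : i + k generalizing i k a b with
  | zero =>
    obtain ⟨rfl, rfl⟩ : i = 0 ∧ k = 0 := by omega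
    simp
  | succ d ih =>
    rw [Function.iterate_succ_apply]
    rcases i with _ | i
    · obtain rfl : k = d + 1 := by omega
      have h : fwdDiff 1 (fun t : ℕ ↦ ((t + a).choose 0 * (t + b).choose (d + 1) : ℤ)) =
          fun t : ℕ ↦ ((t + a).choose 0 * (t + b).choose d : ℤ) := by
        ext t
        simp [fwdDiff, add_right_comm t 1, Nat.choose_succ_succ']
      rw [h, ih 0 d a b (by omega)]
      simp
    rcases k with _ | k
    · obtain rfl : i = d := by omega
      have h : fwdDiff 1 (fun t : ℕ ↦ ((t + a).choose (i + 1) * (t + b).choose 0 : ℤ)) =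
          fun t : ℕ ↦ ((t + a).choose i * (t + b).choose 0 : ℤ) := by
        ext t
        simp [fwdDiff, add_right_comm t 1, Nat.choose_succ_succ']
      rw [h, ih i 0 a b (by omega)]
      simp
    · have h : fwdDiff 1 (fun t : ℕ ↦ ((t + a).choose (i + 1) * (t + b).choose (k + 1) : ℤ)) =
          (fun t : ℕ ↦ ((t + a).choose i * (t + (b + 1)).choose (k + 1) : ℤ)) +
          fun t : ℕ ↦ ((t + a).choose (i + 1) * (t + b).choose k : ℤ) := by
        ext t
        simp only [fwdDiff, add_right_comm t 1, ← add_assoc, Pi.add_apply,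
          Nat.choose_succ_succ' (t + a), Nat.choose_succ_succ' (t + b)]
        push_cast
        ring
      rw [h, fwdDiff_iter_add, ih i (k + 1) a (b + 1) (by omega), ih (i + 1) k a b (by omega)]
      ext t
      simp [Nat.choose_succ_succ']

/-- The telescoping step behind `sum_choose_mul_choose_eq`. -/
lemma sum_choose_mul_choose_telescope (p q h m M : ℕ) (hM : M ≤ m) :
    ∑ j ∈ Finset.range M, p.choose (h + 1 + j) * (q + 1).choose (m - j) +
        p.choose h * q.choose m =
      ∑ j ∈ Finset.range M, (p + 1).choose (h + 1 + j) * q.choose (m - j) +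
        p.choose (h + M) * q.choose (m - M) := by
  induction M with
  | zero => simp
  | succ M ih =>
    specialize ih (by omega)
    obtain ⟨c, rfl⟩ := Nat.exists_eq_add_of_le hM
    have e₁ : M + 1 + c - M = c + 1 := by omega
    have e₂ : M + 1 + c - (M + 1) = c := by omega
    rw [Finset.sum_range_succ, Finset.sum_range_succ, e₁, e₂, add_right_comm h 1 M,
      Nat.choose_succ_succ' p, Nat.choose_succ_succ' q, ← add_assoc h M 1]
    rw [e₁] at ih
    linarith

/-- Splitting the `h`-th of `h + m - 1` marked positions according to whether it lies among the
first `a + h` positions. -/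
lemma sum_choose_mul_choose_eq (h m a r : ℕ) (hh : 1 ≤ h) (hm : 1 ≤ m) (har : a ≤ r) :
    ∑ s ∈ Finset.range (a + 1), (s + h - 1).choose (h - 1) * (r - s + m - 1).choose (m - 1) =
      ∑ j ∈ Finset.range m, (a + h).choose (h + j) * (r - a + m - 1).choose (m - 1 - j) := by
  obtain ⟨h, rfl⟩ := Nat.exists_eq_add_of_le' hh
  obtain ⟨m, rfl⟩ := Nat.exists_eq_add_of_le' hm
  simp only [← add_assoc, Nat.add_sub_cancel]
  induction a with
  | zero =>
    have h₀ (j : ℕ) : (h + 1).choose (h + 1 + (j + 1)) = 0 :=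
      Nat.choose_eq_zero_of_lt (by omega)
    rw [Finset.sum_range_succ' _ m]
    simp [h₀]
  | succ a ih =>
    obtain ⟨q, rfl⟩ := Nat.exists_eq_add_of_le har
    have e₁ : a + 1 + q - a = q + 1 := by omega
    have e₂ : a + 1 + q - (a + 1) = q := by omega
    rw [Finset.sum_range_succ, ih (by omega), e₁, e₂, add_right_comm q 1 m,
      Finset.sum_range_succ, Finset.sum_range_succ _ m, add_right_comm a 1 h]
    have := sum_choose_mul_choose_telescope (a + h + 1) (q + m) h m m le_rfl
    simp only [Nat.sub_self, Nat.choose_zero_right, add_right_comm h 1 m,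
      Nat.choose_succ_succ' (a + h + 1) (h + m)] at this ⊢
    linarith

lemma card_piAntidiag_nat {ι : Type*} [DecidableEq ι] (s : Finset ι) (n : ℕ) :
    (Finset.piAntidiag s n).card = s.card.multichoose n := by
  rw [← Finset.card_finsuppAntidiag_nat_eq_multichoose, Finset.finsuppAntidiag]
  simp

lemma card_piAntidiag_nat' {ι : Type*} [DecidableEq ι] (s : Finset ι) (hs : s.Nonempty) (n : ℕ) :
    (Finset.piAntidiag s n).card = (n + s.card - 1).choose (s.card - 1) := by
  have := hs.card_pos
  rw [card_piAntidiag_nat, Nat.multichoose_eq, add_comm]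
  exact Nat.choose_symm_of_eq_add (by omega)

lemma mem_piAntidiag_univ {ι : Type*} [Fintype ι] [DecidableEq ι] {r : ℕ} {x : ι → ℕ} :
    x ∈ Finset.piAntidiag Finset.univ r ↔ ∑ i, x i = r := by
  simp

/-- Compositions of `r` whose part indexed by `s` has total at most `a`. -/
lemma card_filter_sum_le {ι : Type*} [Fintype ι] [DecidableEq ι] (s : Finset ι)
    (hs : s.Nonempty) (hsc : sᶜ.Nonempty) (a r : ℕ) (har : a ≤ r) :
    ((Finset.piAntidiag (Finset.univ : Finset ι) r).filter fun x ↦ ∑ i ∈ s, x i ≤ a).card =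
      ∑ j ∈ Finset.range sᶜ.card, (a + s.card).choose (s.card + j) *
        (r - a + sᶜ.card - 1).choose (sᶜ.card - 1 - j) := by
  rw [← sum_choose_mul_choose_eq _ _ _ _ hs.card_pos hsc.card_pos har,
    Finset.card_eq_sum_card_fiberwise (f := fun x : ι → ℕ ↦ ∑ i ∈ s, x i)
      (t := Finset.range (a + 1)) (fun x hx ↦ by
        simp only [Finset.mem_coe, Finset.mem_filter] at hx
        simpa [Nat.lt_succ_iff] using hx.2)]
  refine Finset.sum_congr rfl fun k hk ↦ ?_
  rw [Finset.mem_range] at hk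
  rw [← card_piAntidiag_nat' s hs, ← card_piAntidiag_nat' sᶜ hsc, ← Finset.card_product]
  refine Finset.card_bij' (fun x _ ↦ (s.piecewise x (0 : ι → ℕ), s.piecewise (0 : ι → ℕ) x)) (fun p _ ↦ p.1 + p.2)
    ?_ ?_ ?_ ?_
  · intro x hx
    simp only [Finset.mem_filter, mem_piAntidiag_univ] at hx
    obtain ⟨⟨hx, -⟩, hk'⟩ := hx
    have h₁ : ∑ i ∈ s, s.piecewise x (0 : ι → ℕ) i = ∑ i ∈ s, x i :=
      Finset.sum_congr rfl fun i hi ↦ by simp [hi]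
    have h₂ : ∑ i ∈ sᶜ, s.piecewise (0 : ι → ℕ) x i = ∑ i ∈ sᶜ, x i :=
      Finset.sum_congr rfl fun i hi ↦ by rw [Finset.mem_compl] at hi; simp [hi]
    have h₃ := Finset.sum_add_sum_compl s x
    simp only [Finset.mem_product, Finset.mem_piAntidiag, h₁, h₂]
    refine ⟨⟨hk', fun i hi ↦ ?_⟩, by omega, fun i hi ↦ ?_⟩
    · by_contra h; simp [h] at hi
    · rw [Finset.mem_compl]; intro h; simp [h] at hi
  · rintro ⟨y, z⟩ hp
    simp only [Finset.mem_product, Finset.mem_piAntidiag] at hp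
    obtain ⟨⟨hy, hy'⟩, hz, hz'⟩ := hp
    have hzs : ∑ i ∈ s, z i = 0 := Finset.sum_eq_zero fun i hi ↦ by
      by_contra h; exact Finset.mem_compl.1 (hz' i h) hi
    have hys : ∑ i ∈ sᶜ, y i = 0 := Finset.sum_eq_zero fun i hi ↦ by
      by_contra h; exact Finset.mem_compl.1 hi (hy' i h)
    have h₁ : ∑ i ∈ s, (y + z) i = k := by simp [Finset.sum_add_distrib, hzs, hy]
    have h₂ : ∑ i ∈ sᶜ, (y + z) i = r - k := by simp [Finset.sum_add_distrib, hys, hz]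
    have h₃ := Finset.sum_add_sum_compl s (y + z)
    simp only [Finset.mem_filter, mem_piAntidiag_univ]
    omega
  · intro x _
    ext i
    by_cases h : i ∈ s <;> simp [h]
  · rintro ⟨y, z⟩ hp
    simp only [Finset.mem_product, Finset.mem_piAntidiag] at hp
    obtain ⟨⟨hy, hy'⟩, hz, hz'⟩ := hp
    ext i
    · by_cases h : i ∈ s
      · have : z i = 0 := by by_contra h'; exact Finset.mem_compl.1 (hz' i h') h
        simp [h, this]
      · have : y i = 0 := by by_contra h'; exact h (hy' i h')
        simp [h, this]
    · by_cases h : i ∈ s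
      · have : z i = 0 := by by_contra h'; exact Finset.mem_compl.1 (hz' i h') h
        simp [h, this]
      · have : y i = 0 := by by_contra h'; exact h (hy' i h')
        simp [h, this]

/-- Compositions of `2 * t` with a prescribed part exceeding `t`. -/
lemma card_filter_lt_apply {ι : Type*} [Fintype ι] [DecidableEq ι]
    (hι : 2 ≤ Fintype.card ι) (t : ℕ) (i : ι) :
    ((Finset.piAntidiag (Finset.univ : Finset ι) (2 * t)).filter fun x ↦ t < x i).card =
      (t + (Fintype.card ι - 2)).choose (Fintype.card ι - 1) := by
  rcases t with _ | t
  · rw [Nat.choose_eq_zero_of_lt (by omega), Finset.card_eq_zero, Finset.filter_eq_empty_iff]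
    intro x hx
    have := mem_piAntidiag_univ.1 hx
    have := Finset.single_le_sum (f := x) (fun _ _ ↦ Nat.zero_le _) (Finset.mem_univ i)
    omega
  · have : Nonempty ι := ⟨i⟩
    have hc := card_piAntidiag_nat' (Finset.univ : Finset ι) Finset.univ_nonempty t
    rw [Finset.card_univ, show t + Fintype.card ι - 1 = t + 1 + (Fintype.card ι - 2) by omega] at hc
    rw [← hc]
    refine Finset.card_bij' (fun x _ ↦ x - Pi.single i (t + 2)) (fun x _ ↦ x + Pi.single i (t + 2))
      ?_ ?_ ?_ ?_
    · intro x hx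
      simp only [Finset.mem_filter, mem_piAntidiag_univ] at hx ⊢
      have hle : Pi.single i (t + 2) ≤ x := by
        intro j
        rcases eq_or_ne j i with rfl | h
        · simp; omega
        · simp [h]
      have h₁ : ∑ j, (x - Pi.single i (t + 2) + Pi.single i (t + 2) : ι → ℕ) j = ∑ j, x j := by
        rw [tsub_add_cancel_of_le hle]
      simp only [Pi.add_apply, Finset.sum_add_distrib, Finset.sum_pi_single', Finset.mem_univ,
        if_true] at h₁
      omega
    · intro x hx
      simp only [Finset.mem_filter, mem_piAntidiag_univ] at hx ⊢
      simp only [Pi.add_apply, Finset.sum_add_distrib, Finset.sum_pi_single', Finset.mem_univ,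
        if_true, Pi.single_eq_same]
      omega
    · intro x hx
      simp only [Finset.mem_filter] at hx
      ext j
      rcases eq_or_ne j i with rfl | h
      · simp; omega
      · simp [h]
    · intro x _
      simp

/-- The lattice points of the `t`-th dilate of the polytope of `M_n[1, ℓ]` with `h = n - ℓ - 1`. -/
def schubertPoints (n h t : ℕ) : Finset (Fin n → ℕ) :=
  (Finset.piAntidiag Finset.univ (2 * t)).filter fun x ↦
    (∀ i, x i ≤ t) ∧ ∑ i with i.val < h, x i ≤ t

lemma mem_schubertPoints {n h t : ℕ} {x : Fin n → ℕ} :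
    x ∈ schubertPoints n h t ↔
      ∑ i, x i = 2 * t ∧ (∀ i, x i ≤ t) ∧ ∑ i with i.val < h, x i ≤ t := by
  simp [schubertPoints]

lemma card_schubertPoints_add {h m : ℕ} (hh : 1 ≤ h) (hm : 1 ≤ m) (t : ℕ) :
    (schubertPoints (h + m) h t).card + m * (t + (h + m - 2)).choose (h + m - 1) =
      ∑ j ∈ Finset.range m, (t + h).choose (h + j) * (t + (m - 1)).choose (m - 1 - j) := by
  set s : Finset (Fin (h + m)) := Finset.univ.filter fun i ↦ i.val < h with hs
  have hsc : s.card = h := by simp [hs, Fin.card_filter_val_lt]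
  have hscc : sᶜ.card = m := by simp [Finset.card_compl, hsc]
  have hA := card_filter_sum_le s (Finset.card_pos.1 (by omega)) (Finset.card_pos.1 (by omega))
    t (2 * t) (by omega)
  rw [hscc, hsc, show 2 * t - t + m - 1 = t + (m - 1) by omega] at hA
  rw [← hA, ← Finset.card_filter_add_card_filter_not
    (s := Finset.filter _ (Finset.piAntidiag _ _)) (fun x : Fin (h + m) → ℕ ↦ ∀ i, x i ≤ t),
    Finset.filter_filter, Finset.filter_filter]
  congr 1
  · congr 1
    ext x
    simp [schubertPoints, and_comm, hs]
  · have hU : (Finset.piAntidiag (Finset.univ : Finset (Fin (h + m))) (2 * t)).filter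
        (fun x ↦ ∑ i ∈ s, x i ≤ t ∧ ¬ ∀ i, x i ≤ t) =
        sᶜ.biUnion fun i ↦
          (Finset.piAntidiag (Finset.univ : Finset (Fin (h + m))) (2 * t)).filter
            fun x ↦ t < x i := by
      ext x
      simp only [Finset.mem_filter, Finset.mem_biUnion, mem_piAntidiag_univ, Finset.mem_compl, not_forall, not_le]
      have h₃ := Finset.sum_add_sum_compl s x
      constructor
      · rintro ⟨hx, hxs, i, hi⟩
        refine ⟨i, fun his ↦ ?_, hx, hi⟩
        have := Finset.single_le_sum (f := x) (fun _ _ ↦ Nat.zero_le _) his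
        omega
      · rintro ⟨i, his, hx, hi⟩
        have := Finset.single_le_sum (f := x) (fun _ _ ↦ Nat.zero_le _) (Finset.mem_compl.2 his)
        exact ⟨hx, by omega, i, hi⟩
    rw [hU, Finset.card_biUnion]
    · rw [Finset.sum_congr rfl fun i _ ↦ card_filter_lt_apply (by simp; omega) t i]
      simp [hscc]
    · intro i _ j _ hij
      rw [Function.onFun, Finset.disjoint_left]
      intro x hx hx'
      simp only [Finset.mem_filter, mem_piAntidiag_univ] at hx hx'
      have h₁ := Finset.sum_le_univ_sum_of_nonneg (s := {i, j}) (fun k ↦ Nat.zero_le (x k))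
      rw [Finset.sum_pair hij] at h₁
      omega

lemma mem_MklBases_one {n l : ℕ} (hl : 1 ≤ l) (hn : l + 2 ≤ n) {B : Finset (Fin n)} :
    B ∈ MklBases n 1 l ↔ B.card = 2 ∧ (B.filter fun i ↦ i.val < n - l - 1).card ≤ 1 := by
  simp only [MklBases, Finset.mem_filter, Finset.mem_univ, true_and, Finset.mem_range]
  refine and_congr_right fun hB ↦ ⟨fun h ↦ ?_, fun h i hi ↦ ⟨?_, ?_⟩⟩
  · have := (h (n - l - 1) (by omega)).2
    rw [upperHt, if_neg (by omega : ¬ n - l ≤ n - l - 1)] at this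
    unfold pathHeight at this
    split_ifs at this <;> omega
  · have h₁ := Finset.card_filter_add_card_filter_not (s := B) (fun j ↦ j.val < i)
    have h₂ : (B.filter fun j ↦ ¬ j.val < i).card ≤ n - i := by
      calc _ ≤ (Finset.univ.filter fun j : Fin n ↦ ¬ j.val < i).card :=
            Finset.card_le_card (Finset.filter_subset_filter _ (Finset.subset_univ _))
        _ = n - i := by
            have := Finset.card_filter_add_card_filter_not (s := (Finset.univ : Finset (Fin n)))
              (fun j ↦ j.val < i)
            rw [Fin.card_filter_val_lt, Finset.card_univ, Fintype.card_fin] at this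
            omega
    unfold lowerHt pathHeight
    split_ifs <;> omega
  · unfold upperHt pathHeight
    have h₁ : (B.filter fun j ↦ j.val < i).card ≤ 2 := hB ▸ Finset.card_filter_le _ _
    rcases Nat.eq_zero_or_pos i with rfl | hi₀
    · simp
    rw [if_pos (by omega)]
    split_ifs with h₂
    · exact h₁
    · refine le_trans (Finset.card_le_card ?_) h
      intro j hj
      rw [Finset.mem_filter] at hj ⊢
      exact ⟨hj.1, by omega⟩

lemma sum_indVec {n : ℕ} (B s : Finset (Fin n)) :
    ∑ i ∈ s, indVec B i = ((s.filter (· ∈ B)).card : ℝ) := by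
  simp [indVec, Finset.filter_mem_eq_inter]

lemma mem_smul_MklPolytope_one {n l : ℕ} (hl : 1 ≤ l) (hn : l + 2 ≤ n) {t : ℕ} {x : Fin n → ℝ}
    (hx : x ∈ (t : ℝ) • MklPolytope n 1 l) :
    ∑ i, x i = 2 * t ∧ (∀ i, 0 ≤ x i ∧ x i ≤ t) ∧ ∑ i with i.val < n - l - 1, x i ≤ t := by
  obtain ⟨y, hy, rfl⟩ := hx
  have key : MklPolytope n 1 l ⊆ {y : Fin n → ℝ | ∑ i, y i = 2 ∧ (∀ i, 0 ≤ y i ∧ y i ≤ 1) ∧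
      ∑ i with i.val < n - l - 1, y i ≤ 1} := by
    refine convexHull_min ?_ ?_
    · rintro _ ⟨B, hB, rfl⟩
      rw [mem_MklBases_one hl hn] at hB
      refine ⟨?_, fun i ↦ ?_, ?_⟩
      · rw [sum_indVec]; simp [hB.1]
      · unfold indVec; split_ifs <;> simp
      · rw [sum_indVec, Finset.filter_filter]
        refine le_trans ?_ (Nat.cast_le_one.2 hB.2)
        refine Nat.cast_le.2 (Finset.card_le_card fun i hi ↦ ?_)
        simp only [Finset.mem_filter, Finset.mem_univ, true_and] at hi ⊢
        exact hi.symm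
    · rintro y ⟨hy₁, hy₂, hy₃⟩ z ⟨hz₁, hz₂, hz₃⟩ a b ha hb hab
      have hsum (s : Finset (Fin n)) :
          ∑ i ∈ s, (a • y + b • z) i = a * ∑ i ∈ s, y i + b * ∑ i ∈ s, z i := by
        simp [Finset.sum_add_distrib, Finset.mul_sum]
      refine ⟨?_, fun i ↦ ?_, ?_⟩
      · rw [hsum, hy₁, hz₁]; linear_combination 2 * hab
      · have h₁ := hy₂ i
        have h₂ := hz₂ i
        simp only [Pi.add_apply, Pi.smul_apply, smul_eq_mul]
        constructor <;> nlinarith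
      · rw [hsum]; nlinarith
  obtain ⟨h₁, h₂, h₃⟩ := key hy
  have ht : (0 : ℝ) ≤ t := t.cast_nonneg
  simp only [Pi.smul_apply, smul_eq_mul, ← Finset.mul_sum]
  exact ⟨by rw [h₁]; ring, fun i ↦ ⟨mul_nonneg ht (h₂ i).1, mul_le_of_le_one_right ht (h₂ i).2⟩,
    mul_le_of_le_one_right ht h₃⟩

/-- If weights at most `t + 1` add up to `2 * (t + 1)`, then two positive ones can be lowered by one
so that all become at most `t`. -/
lemma exists_pair_of_sum_eq {ι : Type*} [DecidableEq ι] (s : Finset ι) (w : ι → ℕ) (t : ℕ)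
    (hsum : ∑ c ∈ s, w c = 2 * (t + 1)) (hle : ∀ c ∈ s, w c ≤ t + 1) :
    ∃ c ∈ s, ∃ d ∈ s, c ≠ d ∧ 0 < w c ∧ 0 < w d ∧
      ∀ e ∈ s, e ≠ c → e ≠ d → w e ≤ t := by
  have hs : s.Nonempty := by
    by_contra h
    rw [Finset.not_nonempty_iff_eq_empty] at h
    simp [h] at hsum
  obtain ⟨c, hc, hcmax⟩ := s.exists_max_image w hs
  have h₁ := Finset.add_sum_erase s w hc
  have hc' := hle c hc
  have hs' : (s.erase c).Nonempty := by
    by_contra h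
    rw [Finset.not_nonempty_iff_eq_empty] at h
    rw [h, Finset.sum_empty] at h₁
    omega
  obtain ⟨d, hd, hdmax⟩ := (s.erase c).exists_max_image w hs'
  have h₂ := Finset.add_sum_erase _ w hd
  have hcd := hcmax d (Finset.mem_of_mem_erase hd)
  have hpos : 0 < w d := by
    by_contra h
    have : ∑ e ∈ s.erase c, w e = 0 := Finset.sum_eq_zero fun e he ↦ by
      have := hdmax e he; omega
    omega
  refine ⟨c, hc, d, Finset.mem_of_mem_erase hd, (Finset.ne_of_mem_erase hd).symm, by omega, hpos,
    fun e he hec hed ↦ ?_⟩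
  have hec' : e ∈ s.erase c := Finset.mem_erase.2 ⟨hec, he⟩
  have h₃ := Finset.single_le_sum (f := w) (fun _ _ ↦ Nat.zero_le _)
    (Finset.mem_erase.2 ⟨hed, hec'⟩)
  have := hdmax e hec'
  omega

/-- Removing a basis from a point of `schubertPoints n h (t + 1)`. -/
lemma exists_sub_mem_schubertPoints {n h t : ℕ} {x : Fin n → ℕ}
    (hx : x ∈ schubertPoints n h (t + 1)) :
    ∃ a b : Fin n, a ≠ b ∧ ¬ (a.val < h ∧ b.val < h) ∧
      ∃ y ∈ schubertPoints n h t, x = y + Pi.single a 1 + Pi.single b 1 := by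
  rw [mem_schubertPoints] at hx
  obtain ⟨hx₁, hx₂, hx₃⟩ := hx
  set f : Fin n → ℕ := fun i ↦ if i.val < h then 0 else i.val + 1 with hf
  set w : (Fin n → ℕ) → ℕ → ℕ := fun x c ↦ ∑ i with f i = c, x i with hw
  have hf₀ : (Finset.univ.filter fun i ↦ f i = 0) = Finset.univ.filter fun i ↦ i.val < h := by
    ext i; simp [hf]
  have hfs (i : Fin n) (hi : ¬ i.val < h) :
      (Finset.univ.filter fun j ↦ f j = f i) = {i} := by
    ext j
    simp only [hf, Finset.mem_filter, Finset.mem_univ, true_and, Finset.mem_singleton,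
      Fin.ext_iff, if_neg hi]
    by_cases hj : j.val < h
    · rw [if_pos hj]
      exact ⟨fun h' ↦ absurd h' (Nat.succ_ne_zero _).symm, fun h' ↦ absurd (h' ▸ hj) hi⟩
    · rw [if_neg hj]
      omega
  have hmaps : ∀ i ∈ (Finset.univ : Finset (Fin n)), f i ∈ Finset.univ.image f :=
    fun i _ ↦ Finset.mem_image_of_mem f (Finset.mem_univ i)
  obtain ⟨c, -, d, -, hcd, hc₀, hd₀, hcd'⟩ := exists_pair_of_sum_eq (Finset.univ.image f) (w x) t
    (by rw [← hx₁]; exact Finset.sum_fiberwise_of_maps_to hmaps x) (by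
      intro c hc
      obtain ⟨i, -, rfl⟩ := Finset.mem_image.1 hc
      by_cases hi : i.val < h
      · rw [show f i = 0 by simp [hf, hi]]
        simpa only [hw, hf₀] using hx₃
      · simpa only [hw, hfs i hi, Finset.sum_singleton] using hx₂ i)
  obtain ⟨a, ha, hxa⟩ := Finset.exists_ne_zero_of_sum_ne_zero hc₀.ne'
  obtain ⟨b, hb, hxb⟩ := Finset.exists_ne_zero_of_sum_ne_zero hd₀.ne'
  simp only [Finset.mem_filter, Finset.mem_univ, true_and] at ha hb
  have hab : a ≠ b := by rintro rfl; exact hcd (ha.symm.trans hb)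
  have hle : Pi.single a 1 + Pi.single b 1 ≤ x := by
    intro i
    rcases eq_or_ne i a with rfl | hia
    · simp [hab]; omega
    rcases eq_or_ne i b with rfl | hib
    · simp [hia]; omega
    · simp [hia, hib]
  obtain ⟨y, rfl⟩ := exists_add_of_le hle
  have hwy (e : ℕ) : w (Pi.single a 1 + Pi.single b 1 + y) e =
      (if f a = e then 1 else 0) + (if f b = e then 1 else 0) + w y e := by
    simp [hw, Finset.sum_add_distrib, Finset.sum_pi_single']
  have hwle (e : ℕ) (he : w (Pi.single a 1 + Pi.single b 1 + y) e ≤ t + 1) : w y e ≤ t := by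
    by_cases hec : e = c
    · rw [hwy, if_pos (by rw [ha, hec])] at he
      omega
    by_cases hed : e = d
    · rw [hwy, if_pos (by rw [hb, hed] : f b = e)] at he
      omega
    by_cases hei : e ∈ Finset.univ.image f
    · have := hcd' e hei hec hed
      rw [hwy] at this
      omega
    · have : w y e = 0 := Finset.sum_eq_zero fun i hi ↦
        absurd (Finset.mem_image.2 ⟨i, Finset.mem_univ i, (Finset.mem_filter.1 hi).2⟩) hei
      omega
  have hw₀ : ∑ i with i.val < h, y i ≤ t := by
    have := hwle 0 (by simpa only [hw, hf₀] using hx₃)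
    simpa only [hw, hf₀] using this
  refine ⟨a, b, hab, ?_, y, mem_schubertPoints.2 ⟨?_, fun i ↦ ?_, hw₀⟩, by abel⟩
  · rintro ⟨h₁, h₂⟩
    apply hcd
    rw [← ha, ← hb]
    simp [hf, h₁, h₂]
  · simp only [Pi.add_apply, Finset.sum_add_distrib, Finset.sum_pi_single', Finset.mem_univ,
      if_true] at hx₁
    omega
  · by_cases hi : i.val < h
    · exact (Finset.single_le_sum (f := y) (fun _ _ ↦ Nat.zero_le _)
        (Finset.mem_filter.2 ⟨Finset.mem_univ i, hi⟩)).trans hw₀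
    · have := hwle (f i) (by simpa only [hw, hfs i hi, Finset.sum_singleton] using hx₂ i)
      simpa only [hw, hfs i hi, Finset.sum_singleton] using this

lemma natCast_mem_smul_MklPolytope_one {n l : ℕ} (hl : 1 ≤ l) (hn : l + 2 ≤ n) {t : ℕ}
    {x : Fin n → ℕ} (hx : x ∈ schubertPoints n (n - l - 1) t) :
    (fun i ↦ (x i : ℝ)) ∈ (t : ℝ) • MklPolytope n 1 l := by
  have hmem (a b : Fin n) (hab : a ≠ b) (h : ¬ (a.val < n - l - 1 ∧ b.val < n - l - 1)) :
      indVec {a, b} ∈ MklPolytope n 1 l := by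
    refine subset_convexHull ℝ _ ⟨{a, b}, (mem_MklBases_one hl hn).2 ⟨Finset.card_pair hab, ?_⟩, rfl⟩
    rw [Finset.card_le_one]
    intro i hi j hj
    simp only [Finset.mem_filter, Finset.mem_insert, Finset.mem_singleton] at hi hj
    grind
  induction t generalizing x with
  | zero =>
    have h₀ : MklPolytope n 1 l |>.Nonempty :=
      ⟨_, hmem ⟨n - 2, by omega⟩ ⟨n - 1, by omega⟩ (by simp; omega) (by simp; omega)⟩
    have := (mem_schubertPoints.1 hx).2.1
    rw [Nat.cast_zero, Set.zero_smul_set h₀, Set.mem_zero]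
    ext i
    simpa using this i
  | succ t ih =>
    obtain ⟨a, b, hab, h, y, hy, rfl⟩ := exists_sub_mem_schubertPoints hx
    have hconv : Convex ℝ (MklPolytope n 1 l) := convex_convexHull ℝ _
    rw [Nat.cast_succ, hconv.add_smul t.cast_nonneg zero_le_one, one_smul]
    refine Set.mem_add.2 ⟨_, ih hy, _, hmem a b hab h, ?_⟩
    ext i
    rcases eq_or_ne i a with rfl | hia
    · simp [indVec, hab]
    rcases eq_or_ne i b with rfl | hib
    · simp [indVec, hia]
    · simp [indVec, hia, hib]

lemma latticeCount_smul_MklPolytope_one {n l : ℕ} (hl : 1 ≤ l) (hn : l + 2 ≤ n) (t : ℕ) :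
    latticeCount ((t : ℝ) • MklPolytope n 1 l) = (schubertPoints n (n - l - 1) t).card := by
  have hinj : Function.Injective fun (x : Fin n → ℕ) (i : Fin n) ↦ (x i : ℝ) := fun x y h ↦ by
    ext i; exact Nat.cast_injective (congrFun h i)
  rw [latticeCount, ← Set.ncard_coe_finset, ← Set.ncard_image_of_injective _ hinj]
  congr 1
  ext x
  constructor
  · rintro ⟨hx, hint⟩
    obtain ⟨h₁, h₂, h₃⟩ := mem_smul_MklPolytope_one hl hn hx
    have hnat (i : Fin n) : ∃ k : ℕ, x i = k := by
      obtain ⟨k, hk⟩ := hint i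
      have := (h₂ i).1
      rw [hk] at this
      lift k to ℕ using by exact_mod_cast this
      exact ⟨k, by simpa using hk⟩
    choose y hy using hnat
    obtain rfl : x = fun i ↦ (y i : ℝ) := funext hy
    dsimp only at h₁ h₂ h₃
    refine ⟨y, Finset.mem_coe.2 (mem_schubertPoints.2 ⟨?_, fun i ↦ ?_, ?_⟩), rfl⟩
    · exact_mod_cast h₁
    · exact_mod_cast (h₂ i).2
    · exact_mod_cast h₃
  · rintro ⟨y, hy, rfl⟩
    exact ⟨natCast_mem_smul_MklPolytope_one hl hn hy, fun i ↦ ⟨y i, by simp⟩⟩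

lemma normVol_eq_fwdDiff {n : ℕ} (P : Set (Fin n → ℝ)) (d : ℕ) :
    normVol P d = (fwdDiff 1)^[d] (fun t : ℕ ↦ (latticeCount ((t : ℝ) • P) : ℤ)) 0 := by
  rw [fwdDiff_iter_eq_sum_shift, ← Finset.sum_range_reflect, normVol]
  refine Finset.sum_congr rfl fun j hj ↦ ?_
  rw [Finset.mem_range] at hj
  have h₁ : d + 1 - 1 - j = d - j := by omega
  rw [h₁, Nat.sub_sub_self (by omega), Nat.choose_symm (by omega)]
  simp

/-- The normalized volume of the polytope of a rank-2 Schubert matroid. -/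
lemma sigmaVol_one {n l : ℕ} (hl : 1 ≤ l) (hn : l + 2 ≤ n) :
    sigmaVol n 1 l = ∑ j ∈ Finset.range (l + 1), ((n - 1).choose j : ℤ) - (l + 1) := by
  rw [sigmaVol, if_pos ⟨le_rfl, hl, by omega⟩, normVol_eq_fwdDiff]
  obtain ⟨h, hh, rfl⟩ : ∃ h, 1 ≤ h ∧ n = h + (l + 1) := ⟨n - (l + 1), by omega, by omega⟩
  have hd : h + (l + 1) - 1 = h + l := by omega
  have hcount : (fun t : ℕ ↦ (latticeCount ((t : ℝ) • MklPolytope (h + (l + 1)) 1 l) : ℤ)) =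
      (∑ j ∈ Finset.range (l + 1),
        fun t : ℕ ↦ ((t + h).choose (h + j) * (t + l).choose (l - j) : ℤ)) +
      (-(l + 1) : ℤ) • fun t : ℕ ↦ ((t + (h + l - 1)).choose (h + l) * (t + 0).choose 0 : ℤ) := by
    ext t
    have := card_schubertPoints_add hh (show 1 ≤ l + 1 by omega) t
    rw [hd, show h + (l + 1) - 2 = h + l - 1 by omega, Nat.add_sub_cancel] at this
    rw [latticeCount_smul_MklPolytope_one hl hn, show h + (l + 1) - l - 1 = h by omega]
    zify at this
    simp only [Pi.add_apply, Finset.sum_apply, Pi.smul_apply, smul_eq_mul]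
    rw [← this]
    simp only [add_zero, Nat.choose_zero_right]
    push_cast
    ring
  rw [hcount, hd, fwdDiff_iter_add, fwdDiff_iter_finsetSum, fwdDiff_iter_const_smul]
  have h₁ : ∀ j ∈ Finset.range (l + 1), (fwdDiff 1)^[h + l]
      (fun t : ℕ ↦ ((t + h).choose (h + j) * (t + l).choose (l - j) : ℤ)) =
        fun _ ↦ ((h + l).choose (l - j) : ℤ) := by
    intro j hj
    rw [Finset.mem_range] at hj
    have := fwdDiff_iter_choose_mul_choose (h + j) (l - j) h l
    rw [show h + j + (l - j) = h + l by omega] at this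
    rw [this]
    ext
    rw [Nat.choose_symm_of_eq_add (show h + l = h + j + (l - j) by omega)]
  have h₂ := fwdDiff_iter_choose_mul_choose (h + l) 0 (h + l - 1) 0
  rw [add_zero] at h₂
  rw [Finset.sum_congr rfl h₁, h₂, ← Finset.sum_range_reflect]
  have h₃ : ∀ j ∈ Finset.range (l + 1),
      ((h + l).choose (l - (l + 1 - 1 - j)) : ℤ) = (h + l).choose j := by
    intro j hj
    rw [Finset.mem_range] at hj
    rw [show l - (l + 1 - 1 - j) = j by omega]
  simp only [Pi.add_apply, Finset.sum_apply, Pi.smul_apply, Nat.choose_self]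
  rw [Finset.sum_congr rfl h₃]
  simp [sub_eq_add_neg]

/-- Between consecutive descents the one-line notation increases. -/
lemma oneLine_lt_oneLine {m : ℕ} (π : Equiv.Perm (Fin m)) {i j : ℕ} (hij : i < j) (hj : j < m)
    (h : ∀ a, i ≤ a → a < j → ¬ oneLine π (a + 1) < oneLine π a) :
    oneLine π i < oneLine π j := by
  have hstep : ∀ a, i ≤ a → a < j → oneLine π a < oneLine π (a + 1) := by
    intro a ha haj
    refine lt_of_le_of_ne (not_lt.1 (h a ha haj)) fun he ↦ ?_
    rw [oneLine, oneLine, dif_pos (by omega), dif_pos (by omega)] at he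
    have := π.injective (Fin.ext he)
    simp at this
  clear h
  induction j, hij using Nat.le_induction with
  | base => exact hstep i le_rfl (Nat.lt_succ_self i)
  | succ j hij ih =>
    exact (ih (by omega) fun a ha haj ↦ hstep a ha (by omega)).trans
      (hstep j (by omega) (Nat.lt_succ_self j))

lemma descentCount_eq_one_iff {m : ℕ} (π : Equiv.Perm (Fin m)) :
    descentCount π = 1 ↔ ∃ d, (d + 1 < m ∧ oneLine π (d + 1) < oneLine π d) ∧
      ∀ e, e + 1 < m → oneLine π (e + 1) < oneLine π e → e = d := by
  rw [descentCount, Finset.card_eq_one]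
  refine exists_congr fun d ↦ ?_
  rw [Finset.eq_singleton_iff_unique_mem]
  simp only [Finset.mem_filter, Finset.mem_range]
  constructor
  · rintro ⟨⟨-, h⟩, h'⟩
    exact ⟨h, fun e he he' ↦ h' e ⟨by omega, he, he'⟩⟩
  · rintro ⟨h, h'⟩
    exact ⟨⟨by omega, h⟩, fun e he ↦ h' e he.2.1 he.2.2⟩

lemma oneLine_coe {m : ℕ} (π : Equiv.Perm (Fin m)) (i : Fin m) : oneLine π i = π i := by
  simp [oneLine]

lemma card_add_card_compl_fin {m : ℕ} (s : Finset (Fin m)) : s.card + sᶜ.card = m := by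
  simp

/-- The permutation listing the elements of `s` in increasing order, followed by those of `sᶜ`. -/
def shufflePerm {m : ℕ} (s : Finset (Fin m)) : Equiv.Perm (Fin m) :=
  (finCongr (card_add_card_compl_fin s).symm).trans
    (finSumFinEquiv.symm.trans (finSumEquivOfFinset (s := s) rfl rfl))

lemma shufflePerm_of_lt {m : ℕ} (s : Finset (Fin m)) (i : Fin m) (h : i.val < s.card) :
    shufflePerm s i = s.orderEmbOfFin rfl ⟨i, h⟩ := by
  have : finCongr (card_add_card_compl_fin s).symm i = Fin.castAdd sᶜ.card ⟨i, h⟩ := rfl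
  simp only [shufflePerm, Equiv.trans_apply, this, finSumFinEquiv_symm_apply_castAdd,
    finSumEquivOfFinset_inl]

lemma shufflePerm_of_ge {m : ℕ} (s : Finset (Fin m)) (i : Fin m) (h : s.card ≤ i.val) :
    shufflePerm s i = sᶜ.orderEmbOfFin rfl
      ⟨i - s.card, by have := card_add_card_compl_fin s; omega⟩ := by
  have : finCongr (card_add_card_compl_fin s).symm i = Fin.natAdd s.card
      ⟨i - s.card, by have := card_add_card_compl_fin s; omega⟩ := by
    ext
    simp [h]
  simp only [shufflePerm, Equiv.trans_apply, this, finSumFinEquiv_symm_apply_natAdd,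
    finSumEquivOfFinset_inr]

lemma shufflePerm_mem {m : ℕ} (s : Finset (Fin m)) (i : Fin m) :
    shufflePerm s i ∈ s ↔ i.val < s.card := by
  by_cases h : i.val < s.card
  · simp only [shufflePerm_of_lt s i h, h, Finset.orderEmbOfFin_mem]
  · simp only [shufflePerm_of_ge s i (not_lt.1 h), h, iff_false]
    exact Finset.mem_compl.1 (Finset.orderEmbOfFin_mem _ _ _)

/-- Descents of `shufflePerm s` occur only where the elements of `s` end. -/
lemma shufflePerm_descent {m : ℕ} (s : Finset (Fin m)) {e : ℕ} (he : e + 1 < m)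
    (h : oneLine (shufflePerm s) (e + 1) < oneLine (shufflePerm s) e) : e + 1 = s.card := by
  rw [oneLine, oneLine, dif_pos he, dif_pos (by omega), ← Fin.lt_def] at h
  by_contra hne
  rcases lt_or_gt_of_ne hne with hlt | hgt
  · rw [shufflePerm_of_lt _ _ hlt, shufflePerm_of_lt _ _ (show e < s.card by omega),
      OrderEmbedding.lt_iff_lt, Fin.lt_def] at h
    simp at h
  · rw [shufflePerm_of_ge _ _ hgt.le, shufflePerm_of_ge _ _ (show s.card ≤ e by omega),
      OrderEmbedding.lt_iff_lt, Fin.lt_def] at h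
    simp only at h
    omega

lemma descentCount_shufflePerm {m : ℕ} {s : Finset (Fin m)}
    (hs : ¬ IsLowerSet (s : Set (Fin m))) : descentCount (shufflePerm s) = 1 := by
  have hex : ∃ e, e + 1 < m ∧ oneLine (shufflePerm s) (e + 1) < oneLine (shufflePerm s) e := by
    by_contra! hno
    refine hs fun i j hji hi ↦ ?_
    rw [Finset.mem_coe] at hi ⊢
    by_contra hj
    obtain ⟨a, rfl⟩ := (shufflePerm s).surjective i
    obtain ⟨b, rfl⟩ := (shufflePerm s).surjective j
    rw [shufflePerm_mem] at hi hj
    have := oneLine_lt_oneLine (shufflePerm s) (show a.val < b.val by omega) b.isLt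
      fun c _ hcb ↦ not_lt.2 (hno c (by omega))
    rw [oneLine_coe, oneLine_coe] at this
    exact absurd hji (not_le.2 this)
  obtain ⟨e, he, hdesc⟩ := hex
  rw [descentCount_eq_one_iff]
  refine ⟨e, ⟨he, hdesc⟩, fun e' he' hdesc' ↦ ?_⟩
  have h₁ := shufflePerm_descent s he hdesc
  have h₂ := shufflePerm_descent s he' hdesc'
  omega

lemma shufflePerm_eq {m : ℕ} (π : Equiv.Perm (Fin m)) (s : Finset (Fin m))
    (hmem : ∀ i, π i ∈ s ↔ i.val < s.card)
    (hlt : ∀ i j : Fin m, i < j → j.val < s.card → π i < π j)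
    (hge : ∀ i j : Fin m, i < j → s.card ≤ i.val → π i < π j) : shufflePerm s = π := by
  have hc := card_add_card_compl_fin s
  ext1 i
  by_cases h : i.val < s.card
  · have := Finset.orderEmbOfFin_unique (s := s) rfl
      (f := fun j : Fin s.card ↦ π ⟨j, by omega⟩)
      (fun j ↦ (hmem _).2 j.isLt) (fun j k hjk ↦ hlt _ _ hjk k.isLt)
    rw [shufflePerm_of_lt s i h, ← this]
  · have := Finset.orderEmbOfFin_unique (s := sᶜ) rfl
      (f := fun j : Fin sᶜ.card ↦ π ⟨s.card + j, by omega⟩)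
      (fun j ↦ Finset.mem_compl.2 fun h ↦ by simpa using (hmem _).1 h)
      (fun j k hjk ↦ hge _ _ (Fin.lt_def.2 (Nat.add_lt_add_left hjk _))
        (Nat.le_add_right _ _))
    rw [shufflePerm_of_ge s i (not_lt.1 h), ← this]
    exact congrArg π (Fin.ext (Nat.add_sub_cancel' (not_lt.1 h)))

lemma card_isLowerSet_fin (m : ℕ) :
    (Finset.univ.filter fun s : Finset (Fin m) ↦ IsLowerSet (s : Set (Fin m))).card = m + 1 := by
  rw [← Finset.card_range (m + 1)]
  symm
  refine Finset.card_bij' (fun k _ ↦ Finset.univ.filter fun i ↦ i.val < k) (fun s _ ↦ s.card)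
    ?_ ?_ ?_ ?_
  · intro k _
    simp only [Finset.mem_filter, Finset.mem_univ, true_and]
    intro i j hji hi
    rw [Finset.mem_coe, Finset.mem_filter] at hi ⊢
    exact ⟨Finset.mem_univ j, lt_of_le_of_lt hji hi.2⟩
  · intro s _
    have := card_add_card_compl_fin s
    rw [Finset.mem_range]
    omega
  · intro k hk
    rw [Finset.mem_range] at hk
    rw [Fin.card_filter_val_lt]
    omega
  · intro s hs
    simp only [Finset.mem_filter, Finset.mem_univ, true_and] at hs
    ext i
    simp only [Finset.mem_filter, Finset.mem_univ, true_and]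
    constructor
    · intro hi
      by_contra his
      have : s ⊆ Finset.Iio i := fun j hj ↦ by
        rw [Finset.mem_Iio]
        by_contra hij
        exact his (hs (not_lt.1 hij) hj)
      have := Finset.card_le_card this
      rw [Fin.card_Iio] at this
      omega
    · intro hi
      have : Finset.Iic i ⊆ s := fun j hj ↦ hs (Finset.mem_Iic.1 hj) hi
      have := Finset.card_le_card this
      rw [Fin.card_Iic] at this
      omega

/-- The Eulerian number `A_{1,m}` is `2 ^ m - (m + 1)`. -/
lemma eulerianOne_add (m : ℕ) : eulerianOne m + (m + 1) = 2 ^ m := by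
  have hcard := Finset.card_filter_add_card_filter_not
    (s := (Finset.univ : Finset (Finset (Fin m)))) (fun s ↦ IsLowerSet (s : Set (Fin m)))
  rw [card_isLowerSet_fin, Finset.card_univ, Fintype.card_finset, Fintype.card_fin] at hcard
  rw [← hcard, add_comm]
  congr 1
  symm
  refine Finset.card_bij (fun s _ ↦ shufflePerm s) ?_ ?_ ?_
  · intro s hs
    simp only [Finset.mem_filter, Finset.mem_univ, true_and] at hs ⊢
    exact descentCount_shufflePerm hs
  · intro s hs t ht hst
    simp only [Finset.mem_filter, Finset.mem_univ, true_and] at hs ht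
    obtain ⟨d, ⟨hd, hdesc⟩, -⟩ := (descentCount_eq_one_iff _).1 (descentCount_shufflePerm hs)
    have h₁ := shufflePerm_descent s hd hdesc
    have h₂ := shufflePerm_descent t hd (hst ▸ hdesc)
    ext i
    obtain ⟨a, rfl⟩ := (shufflePerm s).surjective i
    rw [shufflePerm_mem, hst, shufflePerm_mem, ← h₁, ← h₂]
  · intro π hπ
    simp only [Finset.mem_filter, Finset.mem_univ, true_and] at hπ
    obtain ⟨d, ⟨hd, hdesc⟩, huniq⟩ := (descentCount_eq_one_iff _).1 hπ
    set s : Finset (Fin m) := (Finset.univ.filter fun i : Fin m ↦ i.val < d + 1).map π.toEmbedding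
      with hs
    have hsc : s.card = d + 1 := by
      rw [hs, Finset.card_map, Fin.card_filter_val_lt]
      omega
    have hmem (i : Fin m) : π i ∈ s ↔ i.val < s.card := by
      rw [hsc, hs]
      simp
    refine ⟨s, ?_, shufflePerm_eq π s hmem ?_ ?_⟩
    · simp only [Finset.mem_filter, Finset.mem_univ, true_and]
      intro hlow
      rw [oneLine, oneLine, dif_pos hd, dif_pos (by omega), ← Fin.lt_def] at hdesc
      have := hlow hdesc.le (Finset.mem_coe.2 ((hmem _).2 (by simp [hsc])))
      rw [Finset.mem_coe, hmem, hsc] at this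
      simp at this
    · intro i j hij hj
      rw [Fin.lt_def, ← oneLine_coe, ← oneLine_coe]
      exact oneLine_lt_oneLine π hij j.isLt fun a _ ha h ↦ by
        have := huniq a (by omega) h
        omega
    · intro i j hij hi
      rw [Fin.lt_def, ← oneLine_coe, ← oneLine_coe]
      exact oneLine_lt_oneLine π hij j.isLt fun a hia ha h ↦ by
        have := huniq a (by omega) h
        omega

/-- Pascal's rule for partial sums of a row of Pascal's triangle. -/
lemma sum_range_choose_succ (n l : ℕ) :
    ∑ j ∈ Finset.range (l + 1), (n + 1).choose j =
      ∑ j ∈ Finset.range l, n.choose j + ∑ j ∈ Finset.range (l + 1), n.choose j := by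
  rw [Finset.sum_range_succ', Finset.sum_range_succ' (fun j ↦ n.choose j) l]
  simp only [Nat.choose_succ_succ', Finset.sum_add_distrib, Nat.choose_zero_right]
  ring

/-- Complementary partial sums of a row of Pascal's triangle. -/
lemma sum_range_choose_add_sum_range_choose (a b : ℕ) :
    ∑ j ∈ Finset.range (a + 1), (a + b + 1).choose j +
      ∑ j ∈ Finset.range (b + 1), (a + b + 1).choose j = 2 ^ (a + b + 1) := by
  rw [← Nat.sum_range_choose, show a + b + 1 + 1 = (a + 1) + (b + 1) by ring,
    Finset.sum_range_add _ (a + 1) (b + 1), ← Finset.sum_range_reflect _ (b + 1)]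
  congr 1
  refine Finset.sum_congr rfl fun j hj ↦ ?_
  rw [Finset.mem_range] at hj
  exact Nat.choose_symm_of_eq_add (by omega)

/-- The volumes of rank-2 Schubert matroid polytopes satisfy the
recursion `σ_n(1, ℓ-1) + σ_n(1, ℓ) + ℓ = σ_{n+1}(1, ℓ)`, the initial values
`σ_n(1,1) = n - 2` for every `n ≥ 3`, and moreover for each `1 ≤ ℓ ≤ n - 3`,
`A_{1,n-1} = σ_n(1, ℓ) + σ_n(1, n-ℓ-2)`. -/
theorem sigma_schubert_recursion_and_eulerian :
    (∀ n l : ℕ, 4 ≤ n → 2 ≤ l → l ≤ n - 2 →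
      sigmaVol n 1 (l - 1) + sigmaVol n 1 l + (l : ℤ) = sigmaVol (n + 1) 1 l) ∧
    (∀ n : ℕ, 3 ≤ n → sigmaVol n 1 1 = (n : ℤ) - 2) ∧
    (∀ n l : ℕ, 1 ≤ l → l ≤ n - 3 →
      (eulerianOne (n - 1) : ℤ) = sigmaVol n 1 l + sigmaVol n 1 (n - l - 2)) := by
  refine ⟨fun n l hn hl hln ↦ ?_, fun n hn ↦ ?_, fun n l hl hln ↦ ?_⟩
  · obtain ⟨l, rfl⟩ := Nat.exists_eq_add_of_le' (show 1 ≤ l by omega)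
    obtain ⟨n, rfl⟩ := Nat.exists_eq_add_of_le' (show 1 ≤ n by omega)
    rw [sigmaVol_one (by omega) (by omega), sigmaVol_one (by omega) (by omega),
      sigmaVol_one (by omega) (by omega)]
    have := sum_range_choose_succ n (l + 1)
    zify at this
    simp only [Nat.add_sub_cancel]
    rw [this]
    push_cast
    ring
  · obtain ⟨n, rfl⟩ := Nat.exists_eq_add_of_le' (show 1 ≤ n by omega)
    rw [sigmaVol_one le_rfl hn]
    simp [Finset.sum_range_succ]
    ring
  · obtain ⟨k, rfl⟩ := Nat.exists_eq_add_of_le (show l + 3 ≤ n by omega)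
    rw [sigmaVol_one hl (by omega), sigmaVol_one (by omega) (by omega),
      show l + 3 + k - l - 2 = k + 1 by omega, show l + 3 + k - 1 = l + (k + 1) + 1 by omega]
    have h₁ := sum_range_choose_add_sum_range_choose l (k + 1)
    have h₂ := eulerianOne_add (l + (k + 1) + 1)
    zify at h₁ h₂
    push_cast at h₁ h₂ ⊢
    linarith
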